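/- Let a, b : ℤ → ℝ, neither identically zero, with the Hurwitz-type matrix H(a,b) totally nonnegative, and suppose there exists K ∈ ℤ such that a_k ≠ 0 for every k ≤ K. Then there exists a real number r ≥ 0 such that both ratio sequences converge to r as k → −∞: lim_{k→−∞} a_k / a_{k+1} = lim_{k→−∞} b_k / b_{k+1} = r (in particular the two Laurent series have the same inner radius of convergence r). -/

import Mathlib

/-- A doubly infinite real matrix is totally nonnegative if all its minors
(with rows and columns selected in increasing order) are nonnegative. -/
def TotallyNonneg (M : ℤ → ℤ → ℝ) : Prop :=
  ∀ (k : ℕ) (i j : Fin k → ℤ), StrictMono i → StrictMono j →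
    0 ≤ (Matrix.of fun r s => M (i r) (j s)).det

/-- The doubly infinite Hurwitz-type matrix of two sequences `a b : ℤ → ℝ`:
row `2m` is `j ↦ a (j - m)` and row `2m+1` is `j ↦ b (j - m)`. -/
def hurwitz (a b : ℤ → ℝ) : ℤ → ℤ → ℝ :=
  fun i j => if 2 ∣ i then a (j - i / 2) else b (j - (i - 1) / 2)

theorem TotallyNonneg.apply_nonneg {M : ℤ → ℤ → ℝ} (hM : TotallyNonneg M) (i j : ℤ) :
    0 ≤ M i j := by
  simpa using hM 1 (fun _ => i) (fun _ => j) (Subsingleton.strictMono _)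
    (Subsingleton.strictMono _)

theorem TotallyNonneg.mul_le_mul {M : ℤ → ℤ → ℝ} (hM : TotallyNonneg M) {i i' j j' : ℤ}
    (hi : i < i') (hj : j < j') : M i j' * M i' j ≤ M i j * M i' j' := by
  have h := hM 2 ![i, i'] ![j, j'] (by simpa [Fin.strictMono_iff_lt_succ] using hi)
    (by simpa [Fin.strictMono_iff_lt_succ] using hj)
  simpa [Matrix.det_fin_two] using h

theorem hurwitz_even (a b : ℤ → ℝ) (m j : ℤ) : hurwitz a b (2 * m) j = a (j - m) := by
  simp [hurwitz]

theorem hurwitz_odd (a b : ℤ → ℝ) (m j : ℤ) : hurwitz a b (2 * m + 1) j = b (j - m) := by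
  have h : ¬ (2 : ℤ) ∣ 2 * m + 1 := by omega
  simp [hurwitz, h]

theorem stmt8 (a b : ℤ → ℝ) (ha : ∃ n, a n ≠ 0) (hb : ∃ n, b n ≠ 0)
    (hH : TotallyNonneg (hurwitz a b))
    (K : ℤ) (hK : ∀ k : ℤ, k ≤ K → a k ≠ 0) :
    ∃ r : ℝ, 0 ≤ r ∧
      Filter.Tendsto (fun k : ℤ => a k / a (k + 1)) Filter.atBot (nhds r) ∧
      Filter.Tendsto (fun k : ℤ => b k / b (k + 1)) Filter.atBot (nhds r) := by
  have ha0 : ∀ k, 0 ≤ a k := fun k => by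
    simpa only [hurwitz_even, sub_zero] using hH.apply_nonneg (2 * 0) k
  have hb0 : ∀ k, 0 ≤ b k := fun k => by
    simpa only [hurwitz_odd, sub_zero] using hH.apply_nonneg (2 * 0 + 1) k
  have hapos : ∀ k, k ≤ K → 0 < a k := fun k hk => (ha0 k).lt_of_ne' (hK k hk)
  have haa : ∀ k, a (k + 1) * a (k - 1) ≤ a k * a k := fun k => by
    have h := hH.mul_le_mul (i := 2 * 0) (i' := 2 * 1) (by norm_num) (lt_add_one k)
    simpa only [hurwitz_even, sub_zero, add_sub_cancel_right] using h
  have hab : ∀ k, a (k + 1) * b k ≤ a k * b (k + 1) := fun k => by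
    have h := hH.mul_le_mul (i := 2 * 0) (i' := 2 * 0 + 1) (by norm_num) (lt_add_one k)
    simpa only [hurwitz_even, hurwitz_odd, sub_zero] using h
  have hba : ∀ x y, x < y → b y * a (x - 1) ≤ b x * a (y - 1) := fun x y hxy => by
    have h := hH.mul_le_mul (i := 2 * 0 + 1) (i' := 2 * 1) (by norm_num) hxy
    simpa only [hurwitz_even, hurwitz_odd, sub_zero] using h
  obtain ⟨n, hn⟩ := hb
  have hbpos : ∀ k, k ≤ K → k < n → 0 < b k := fun k hk hkn => by
    have h := hba k n hkn
    have h' : 0 < b n * a (k - 1) :=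
      mul_pos ((hb0 n).lt_of_ne' hn) (hapos _ (by omega))
    exact pos_of_mul_pos_left (h'.trans_le h) (ha0 _)
  have hmono : Monotone fun k : ℤ => a (min k (K - 1)) / a (min k (K - 1) + 1) := by
    refine monotone_int_of_le_succ fun k => ?_
    rcases lt_or_ge k (K - 1) with hk | hk
    · rw [min_eq_left hk.le, min_eq_left (by omega : k + 1 ≤ K - 1),
        div_le_div_iff₀ (hapos _ (by omega)) (hapos _ (by omega))]
      have h := haa (k + 1)
      rw [add_sub_cancel_right] at h
      linarith
    · rw [min_eq_right hk, min_eq_right (by omega : K - 1 ≤ k + 1)]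
  have hnonneg : ∀ k : ℤ, 0 ≤ a (min k (K - 1)) / a (min k (K - 1) + 1) :=
    fun k => div_nonneg (ha0 _) (ha0 _)
  have hlim := tendsto_atBot_ciInf hmono ⟨0, Set.forall_mem_range.2 hnonneg⟩
  set r : ℝ := ⨅ k : ℤ, a (min k (K - 1)) / a (min k (K - 1) + 1)
  have hra : Filter.Tendsto (fun k : ℤ => a k / a (k + 1)) Filter.atBot (nhds r) := by
    refine hlim.congr' ?_
    filter_upwards [Filter.eventually_le_atBot (K - 1)] with k hk
    rw [min_eq_left hk]
  have hra' : Filter.Tendsto (fun k : ℤ => a (k - 1) / a k) Filter.atBot (nhds r) := by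
    have hshift : Filter.Tendsto (fun k : ℤ => k - 1) Filter.atBot Filter.atBot :=
      Filter.tendsto_atBot_add_const_right _ (-1) Filter.tendsto_id
    simpa [Function.comp_def] using hra.comp hshift
  refine ⟨r, le_ciInf hnonneg, hra, tendsto_of_tendsto_of_tendsto_of_le_of_le' hra' hra ?_ ?_⟩
  all_goals
    filter_upwards [Filter.eventually_le_atBot (K - 1), Filter.eventually_le_atBot (n - 2)]
      with k hk hkn
    have hbk := hbpos (k + 1) (by omega) (by omega)
  · rw [div_le_div_iff₀ (hapos _ (by omega)) hbk]
    have h := hba k (k + 1) (lt_add_one k)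
    rw [add_sub_cancel_right] at h
    linarith
  · rw [div_le_div_iff₀ hbk (hapos _ (by omega))]
    linarith [hab k]
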